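/- arXiv:2407.01954 — 6 statements merged into one kernel-verified Lean document; each statement's English description precedes it below -/
import Mathlib

section
/- One-dimensional reduction (Proposition 1, semi-Euclidean model): let E be a real inner product space, J : E →L[ℝ] E a symmetric linear involution, f : E → ℝ a differentiable transnormal function with eikonal function a : ℝ → ℝ (i.e. ⟪∇f(x), J(∇f(x))⟫ = a (f x) for all x), let F̂ : ℝ × ℝ × ℝ → ℝ be any function and w : ℝ → ℝ differentiable. Then u := w ∘ f satisfies F̂(f x, u x, ⟪∇u(x), J(∇u(x))⟫) = 0 for every x ∈ E if and only if w satisfies F̂(t, w t, a t · (deriv w t)²) = 0 for every t in the range of f. -/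
open Real Set
open scoped RealInnerProductSpace

/-- Chain rule for the gradient of a scalar function post-composed with a real function. -/
theorem HasDerivAt.comp_hasGradientAt {E : Type*} [NormedAddCommGroup E] [InnerProductSpace ℝ E]
    [CompleteSpace E] {f : E → ℝ} {f' x : E} {w : ℝ → ℝ} {w' : ℝ}
    (hw : HasDerivAt w w' (f x)) (hf : HasGradientAt f f' x) :
    HasGradientAt (w ∘ f) (w' • f') x := by
  rw [hasGradientAt_iff_hasFDerivAt] at hf ⊢
  simpa using hw.comp_hasFDerivAt x hf

/-- One-dimensional reduction (Proposition 1, semi-Euclidean model):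
for a transnormal `f` with eikonal function `a`, `u = w ∘ f` solves
`F̂(f x, u x, ⟪∇u, J ∇u⟫) = 0` on `E` iff `w` solves
`F̂(t, w t, a t (w' t)²) = 0` on the range of `f`. -/
theorem one_dimensional_reduction
    {E : Type*} [NormedAddCommGroup E] [InnerProductSpace ℝ E] [CompleteSpace E]
    (J : E →L[ℝ] E) (hJsymm : ∀ x y : E, ⟪J x, y⟫ = ⟪x, J y⟫)
    (hJinv : ∀ x : E, J (J x) = x)
    (f : E → ℝ) (hf : Differentiable ℝ f)
    (a : ℝ → ℝ) (hfa : ∀ x : E, ⟪gradient f x, J (gradient f x)⟫ = a (f x))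
    (F : ℝ × ℝ × ℝ → ℝ)
    (w : ℝ → ℝ) (hw : Differentiable ℝ w) :
    (∀ x : E,
        F (f x, (w ∘ f) x, ⟪gradient (w ∘ f) x, J (gradient (w ∘ f) x)⟫) = 0) ↔
    (∀ t ∈ Set.range f, F (t, w t, a t * (deriv w t) ^ 2) = 0) := by
  have key (x : E) : ⟪gradient (w ∘ f) x, J (gradient (w ∘ f) x)⟫ =
      a (f x) * (deriv w (f x)) ^ 2 := by
    rw [((hw (f x)).hasDerivAt.comp_hasGradientAt (hf x).hasGradientAt).gradient, map_smul,
      real_inner_smul_left, real_inner_smul_right, hfa]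
    ring
  simp only [key, Set.forall_mem_range, Function.comp_apply]
end

section
/- ODE core of Theorem 1 (local solvability of the reduced equation): let F̂ : ℝ × ℝ × ℝ → ℝ be continuously differentiable, a : ℝ → ℝ continuous, and let (t₀, r₀, p₀) ∈ ℝ³ satisfy F̂(t₀, r₀, p₀) = 0, ∂F̂/∂p (t₀, r₀, p₀) ≠ 0 (derivative in the third variable), and a(t₀) · p₀ > 0. Then there exist ε > 0 and a continuously differentiable function w : (t₀ − ε, t₀ + ε) → ℝ with w(t₀) = r₀ such that F̂(t, w t, a t · (deriv w t)²) = 0 for every t ∈ (t₀ − ε, t₀ + ε). -/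
open Real Set
open scoped RealInnerProductSpace

open scoped NNReal Topology

/-- Local **Picard–Lindelöf theorem** for a time-dependent vector field which, on a neighbourhood of
the initial point, is jointly continuous and uniformly Lipschitz in the space variable. The solution
is `C¹` and its graph stays in the given neighbourhood. -/
theorem exists_contDiffOn_hasDerivAt_of_lipschitzOnWith {E : Type*} [NormedAddCommGroup E]
    [NormedSpace ℝ E] [CompleteSpace E] {f : ℝ → E → E} {s : Set (ℝ × E)} {t₀ : ℝ} {x₀ : E}
    {K : ℝ≥0} (hs : s ∈ 𝓝 (t₀, x₀)) (hc : ContinuousOn (Function.uncurry f) s)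
    (hl : ∀ t, LipschitzOnWith K (f t) {x | (t, x) ∈ s}) :
    ∃ ε > 0, ∃ w : ℝ → E, w t₀ = x₀ ∧ ContDiffOn ℝ 1 w (Ioo (t₀ - ε) (t₀ + ε)) ∧
      ∀ t ∈ Ioo (t₀ - ε) (t₀ + ε), (t, w t) ∈ s ∧ HasDerivAt w (f t (w t)) t := by
  have hbound : ∀ᶠ z in 𝓝 (t₀, x₀), ‖Function.uncurry f z‖ < ‖f t₀ x₀‖ + 1 :=
    (hc.continuousAt hs).norm.eventually_lt_const (lt_add_one _)
  obtain ⟨δ, hδ, hball⟩ := Metric.nhds_basis_closedBall.eventually_iff.mp (hbound.and hs)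
  rw [← closedBall_prod_same] at hball
  have hball' : ∀ {t x}, t ∈ Metric.closedBall t₀ δ → x ∈ Metric.closedBall x₀ δ →
      ‖f t x‖ < ‖f t₀ x₀‖ + 1 ∧ (t, x) ∈ s := fun ht hx => hball (Set.mk_mem_prod ht hx)
  set L : ℝ≥0 := ‖f t₀ x₀‖₊ + 1
  obtain ⟨η, hη, hηδ, hηL⟩ : ∃ η : ℝ, 0 < η ∧ η ≤ δ ∧ L * η ≤ δ := by
    have hL0 : (0 : ℝ) < L := by positivity
    refine ⟨min δ (δ / L), by positivity, min_le_left _ _, ?_⟩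
    calc (L : ℝ) * min δ (δ / L) ≤ L * (δ / L) := by gcongr; exact min_le_right _ _
      _ = δ := by field_simp
  have hIcc : Icc (t₀ - η) (t₀ + η) ⊆ Metric.closedBall t₀ δ := by
    rw [← Real.closedBall_eq_Icc]
    exact Metric.closedBall_subset_closedBall hηδ
  have hPL : IsPicardLindelof f (tmin := t₀ - η) (tmax := t₀ + η) ⟨t₀, by simp [hη.le]⟩ x₀
      (.mk δ hδ.le) 0 L K :=
    { lipschitzOnWith := fun t ht => (hl t).mono fun x hx => (hball' (hIcc ht) hx).2
      continuousOn := fun x hx => hc.comp (f := fun t => (t, x)) (by fun_prop)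
        fun t ht => (hball' (hIcc ht) hx).2
      norm_le := fun t ht x hx => (hball' (hIcc ht) hx).1.le
      mul_max_le := by simpa using hηL }
  obtain ⟨w, hw₀, hw⟩ := hPL.exists_eq_forall_mem_Icc_hasDerivWithinAt₀
  replace hw₀ : w t₀ = x₀ := hw₀
  have hnhds : Ioo (t₀ - η) (t₀ + η) ∈ 𝓝 t₀ := Ioo_mem_nhds (by linarith) (by linarith)
  have hderiv : ∀ t ∈ Ioo (t₀ - η) (t₀ + η), HasDerivAt w (f t (w t)) t := fun t ht =>
    (hw t (Ioo_subset_Icc_self ht)).hasDerivAt (Icc_mem_nhds ht.1 ht.2)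
  have hwc : ContinuousAt (fun t => (t, w t)) t₀ :=
    continuousAt_id.prodMk (hderiv t₀ (mem_of_mem_nhds hnhds)).continuousAt
  have hmem : ∀ᶠ t in 𝓝 t₀, (t, w t) ∈ s ∧ HasDerivAt w (f t (w t)) t := by
    filter_upwards [hwc.eventually_mem (by simpa only [hw₀] using hs), hnhds] with t h₁ h₂
    exact ⟨h₁, hderiv t h₂⟩
  obtain ⟨ε, hε, h⟩ := Metric.eventually_nhds_iff_ball.mp hmem
  rw [Real.ball_eq_Ioo] at h
  refine ⟨ε, hε, w, hw₀, ?_, h⟩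
  have hcont : ContinuousOn w (Ioo (t₀ - ε) (t₀ + ε)) := fun t ht =>
    (h t ht).2.continuousAt.continuousWithinAt
  rw [contDiffOn_one_iff_derivWithin isOpen_Ioo.uniqueDiffOn]
  refine ⟨fun t ht => (h t ht).2.differentiableAt.differentiableWithinAt, ?_⟩
  refine (hc.comp (f := fun t => (t, w t)) (by fun_prop) fun t ht => (h t ht).1).congr
    fun t ht => ?_
  exact (h t ht).2.hasDerivWithinAt.derivWithin (isOpen_Ioo.uniqueDiffOn t ht)

/-- **Implicit function theorem** for a scalar equation: if `G` is `C¹` with nonzero partial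
derivative in the last variable at a zero `(u, p₀)`, the zero set of `G` near `(u, p₀)` contains the
graph of a `C¹` function. -/
theorem ContDiffAt.exists_implicit_of_deriv_ne_zero {E : Type*} [NormedAddCommGroup E]
    [NormedSpace ℝ E] [CompleteSpace E] {G : E × ℝ → ℝ} {u : E} {p₀ : ℝ}
    (hG : ContDiffAt ℝ 1 G (u, p₀)) (hG₀ : G (u, p₀) = 0)
    (hGp : deriv (fun p => G (u, p)) p₀ ≠ 0) :
    ∃ φ : E → ℝ, φ u = p₀ ∧ ContDiffAt ℝ 1 φ u ∧ ∀ᶠ z in 𝓝 u, G (z, φ z) = 0 := by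
  set A : ℝ →L[ℝ] ℝ := fderiv ℝ G (u, p₀) ∘L .inr ℝ E ℝ
  have hderiv : HasFDerivAt (fun p => G (u, p)) A p₀ :=
    (hG.differentiableAt one_ne_zero).hasFDerivAt.comp p₀ (hasFDerivAt_prodMk_right u p₀)
  have hA1 : A 1 ≠ 0 := by rwa [hderiv.hasDerivAt.deriv] at hGp
  have hinv : A.IsInvertible := by
    refine ⟨ContinuousLinearEquiv.unitsEquivAut ℝ (Units.mk0 (A 1) hA1), ?_⟩
    ext
    simp
  refine ⟨hG.implicitFunction one_ne_zero hinv, hG.implicitFunction_apply_self one_ne_zero hinv,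
    hG.contDiffAt_implicitFunction one_ne_zero hinv, ?_⟩
  simpa only [hG₀] using hG.eventually_apply_implicitFunction one_ne_zero hinv

/-- ODE core of Theorem 1: local solvability of the reduced fully nonlinear
first-order ODE `F̂(t, w t, a t (w' t)²) = 0` with `w t₀ = r₀`. -/
theorem reduced_ODE_local_solvability
    (F : ℝ × ℝ × ℝ → ℝ) (hF : ContDiff ℝ 1 F)
    (a : ℝ → ℝ) (ha : Continuous a)
    (t₀ r₀ p₀ : ℝ)
    (hF0 : F (t₀, r₀, p₀) = 0)
    (hFp : deriv (fun p => F (t₀, r₀, p)) p₀ ≠ 0)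
    (hap : a t₀ * p₀ > 0) :
    ∃ ε > 0, ∃ w : ℝ → ℝ, w t₀ = r₀ ∧
      ContDiffOn ℝ 1 w (Set.Ioo (t₀ - ε) (t₀ + ε)) ∧
      ∀ t ∈ Set.Ioo (t₀ - ε) (t₀ + ε), F (t, w t, a t * (deriv w t) ^ 2) = 0 := by
  have ha₀ : a t₀ ≠ 0 := left_ne_zero_of_mul hap.ne'
  obtain ⟨φ, hφ₀, hφ, hφF⟩ := ContDiffAt.exists_implicit_of_deriv_ne_zero
    (G := fun z : (ℝ × ℝ) × ℝ => F (z.1.1, z.1.2, z.2)) (u := (t₀, r₀)) (p₀ := p₀)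
    (by fun_prop) hF0 hFp
  have hφ_ne : φ (t₀, r₀) ≠ 0 := hφ₀ ▸ right_ne_zero_of_mul hap.ne'
  have hroot : ContDiffAt ℝ 1 (fun z => √|φ z|) (t₀, r₀) :=
    (hφ.abs hφ_ne).sqrt (abs_ne_zero.mpr hφ_ne)
  obtain ⟨K, s, hs, hK⟩ := hroot.exists_lipschitzOnWith
  let c : ℝ → ℝ := fun t => (√|a t|)⁻¹
  have hc : ∀ t, a t ≠ 0 → ContinuousAt c t := fun t ht =>
    (ha.abs.sqrt.continuousAt).inv₀ (Real.sqrt_ne_zero'.mpr (abs_pos.mpr ht))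
  have hcle : ∀ᶠ z : ℝ × ℝ in 𝓝 (t₀, r₀), ‖c z.1‖₊ < ‖c t₀‖₊ + 1 :=
    ((hc t₀ ha₀).comp (f := Prod.fst) (x := (t₀, r₀)) continuousAt_fst).nnnorm.eventually_lt_const
      (lt_add_one _)
  have hpos : ∀ᶠ z : ℝ × ℝ in 𝓝 (t₀, r₀), 0 < a z.1 * φ z :=
    ((ha.comp continuous_fst).continuousAt.mul hφ.continuousAt).eventually_const_lt
      (by simpa [hφ₀] using hap)
  obtain ⟨ε, hε, w, hw₀, hw, h⟩ := exists_contDiffOn_hasDerivAt_of_lipschitzOnWith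
    (f := fun t r => c t * √|φ (t, r)|) (K := (‖c t₀‖₊ + 1) * K)
    (Filter.inter_mem hs (hcle.and (hpos.and hφF)))
    (ContinuousOn.mul
      (fun z hz => ((hc z.1 (left_ne_zero_of_mul hz.2.2.1.ne')).comp
        continuousAt_fst).continuousWithinAt)
      (hK.continuousOn.mono inter_subset_left))
    (fun t => LipschitzOnWith.of_dist_le_mul fun x hx y hy => by
      have hxy := hK.dist_le_mul _ hx.1 _ hy.1
      have hct : ‖c t‖ ≤ ‖c t₀‖ + 1 := by exact_mod_cast hx.2.1.le
      rw [dist_eq_norm] at hxy ⊢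
      rw [← mul_sub, norm_mul]
      calc ‖c t‖ * ‖√|φ (t, x)| - √|φ (t, y)|‖
          ≤ (‖c t₀‖ + 1) * (K * dist (t, x) (t, y)) := by gcongr
        _ = _ := by simp [Prod.dist_eq, mul_assoc])
  refine ⟨ε, hε, w, hw₀, hw, fun t ht => ?_⟩
  obtain ⟨⟨-, -, hapos, hFz⟩, hd⟩ := h t ht
  dsimp only at hapos hFz
  suffices a t * deriv w t ^ 2 = φ (t, w t) by rwa [this]
  have ha_ne : a t ≠ 0 := left_ne_zero_of_mul hapos.ne'
  rw [hd.deriv, mul_pow, inv_pow, sq_sqrt (abs_nonneg _), sq_sqrt (abs_nonneg _), ← div_eq_inv_mul,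
    ← abs_div, abs_of_pos (by rwa [div_pos_iff, ← mul_pos_iff, mul_comm]), mul_div_cancel₀ _ ha_ne]
end

section
/- Hahn's isoparametric polynomials on semi-Euclidean space: let E be a finite-dimensional real inner product space, J : E →L[ℝ] E a symmetric linear involution, B(x,y) := ⟪J x, y⟫, A : E →L[ℝ] E a B-symmetric linear map (B(A x, y) = B(x, A y) for all x, y), a₀ ∈ E and α ∈ ℝ such that A ∘ A = α • A and A a₀ = α • a₀. Then the function f : E → ℝ, f(x) = B(A x, x) + 2 B(a₀, x), is differentiable with semi-Riemannian gradient ∇_g f(x) = J(∇f(x)) = 2 (A x + a₀), and it is transnormal with B(∇_g f(x), ∇_g f(x)) = 4 α f(x) + β for all x ∈ E, where β := 4 B(a₀, a₀). -/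
open Real Set
open scoped RealInnerProductSpace

/-- Hahn's isoparametric polynomials on semi-Euclidean space: with
`B(x,y) = ⟪J x, y⟫`, a `B`-symmetric `A` with `A ∘ A = α • A`, `A a₀ = α • a₀`,
the function `f x = B(A x, x) + 2 B(a₀, x)` is differentiable, its
semi-Riemannian gradient is `J (∇ f x) = 2 (A x + a₀)`, and it is transnormal:
`B(∇_g f, ∇_g f) = 4 α f + β` with `β = 4 B(a₀, a₀)`. -/
theorem hahn_isoparametric_polynomial
    {E : Type*} [NormedAddCommGroup E] [InnerProductSpace ℝ E] [FiniteDimensional ℝ E]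
    (J : E →L[ℝ] E) (hJsymm : ∀ x y : E, ⟪J x, y⟫ = ⟪x, J y⟫)
    (hJinv : ∀ x : E, J (J x) = x)
    (A : E →L[ℝ] E) (a₀ : E) (α : ℝ)
    (hAsymm : ∀ x y : E, ⟪J (A x), y⟫ = ⟪J x, A y⟫)
    (hA2 : ∀ x : E, A (A x) = α • A x)
    (hAa : A a₀ = α • a₀)
    (f : E → ℝ) (hfdef : ∀ x : E, f x = ⟪J (A x), x⟫ + 2 * ⟪J a₀, x⟫) :
    Differentiable ℝ f ∧
      (∀ x : E, J (gradient f x) = (2 : ℝ) • (A x + a₀)) ∧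
      (∀ x : E, ⟪J (J (gradient f x)), J (gradient f x)⟫ =
          4 * α * f x + 4 * ⟪J a₀, a₀⟫) := by
  have hgrad (x : E) : HasGradientAt f ((2 : ℝ) • J (A x + a₀)) x := by
    rw [hasGradientAt_iff_hasFDerivAt, funext hfdef]
    have hquad := ((J.comp A).hasFDerivAt (x := x)).inner ℝ (hasFDerivAt_id x)
    have hlin := ((innerSL ℝ (J a₀)).hasFDerivAt (x := x)).const_mul 2
    refine (hquad.add hlin).congr_fderiv ?_
    ext y
    have hsymm : ⟪J (A y), x⟫ = ⟪J (A x), y⟫ := by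
      rw [hAsymm, hJsymm, real_inner_comm]
    simp [hsymm]
    ring
  have hJgrad (x : E) : J (gradient f x) = (2 : ℝ) • (A x + a₀) := by
    rw [(hgrad x).gradient, map_smul, hJinv]
  refine ⟨fun x ↦ (hgrad x).differentiableAt, hJgrad, fun x ↦ ?_⟩
  have hAA : ⟪J (A x), A x⟫ = α * ⟪J (A x), x⟫ := by
    rw [← hAsymm, hA2, map_smul, real_inner_smul_left]
  have hAa₀ : ⟪J (A x), a₀⟫ = α * ⟪J a₀, x⟫ := by
    rw [hAsymm, hAa, real_inner_smul_right, hJsymm, real_inner_comm]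
  have ha₀A : ⟪J a₀, A x⟫ = α * ⟪J a₀, x⟫ := by
    rw [← hAsymm, hAa, map_smul, real_inner_smul_left]
  rw [hJgrad, hfdef]
  simp only [map_smul, map_add, real_inner_smul_left, real_inner_smul_right, inner_add_left,
    inner_add_right, hAA, hAa₀, ha₀A]
  ring
end

section
/- Explicit eikonal solutions on semi-Euclidean space (Example 1): let E be a real inner product space, J : E →L[ℝ] E a symmetric linear involution, f : E → ℝ differentiable with ⟪∇f(x), J(∇f(x))⟫ = 4 α f(x) + β for all x, where α ≠ 0 and β ∈ ℝ, and set t⋆ := −β/(4α). Let Û : ℝ → ℝ be continuous with Û(t) / (4 α t + β) ≥ 0 for all t < t⋆, fix t₀ < t⋆, and define w(t) := ∫_{t₀}^{t} √(Û(σ)/(4 α σ + β)) dσ for t < t⋆. Then u := w ∘ f satisfies the eikonal equation ⟪∇u(x), J(∇u(x))⟫ = Û(f x) for every x ∈ E with f(x) < t⋆, and u is constant on each level set of f. -/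
open Real Set intervalIntegral
open scoped RealInnerProductSpace

/-- Chain rule for the gradient of a real function of a scalar field. -/
theorem HasDerivAt.comp_hasGradientAt_scalar
    {E : Type*} [NormedAddCommGroup E] [InnerProductSpace ℝ E] [CompleteSpace E]
    {w : ℝ → ℝ} {w' : ℝ} {f : E → ℝ} {g x : E}
    (hw : HasDerivAt w w' (f x)) (hf : HasGradientAt f g x) :
    HasGradientAt (w ∘ f) (w' • g) x := by
  rw [hasGradientAt_iff_hasFDerivAt] at hf ⊢
  simpa using hw.comp_hasFDerivAt x hf

/-- An affine function of nonzero slope does not vanish to the left of its root. -/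
theorem affine_ne_zero_of_lt_root {a b t : ℝ} (ha : a ≠ 0) (ht : t < -b / a) :
    a * t + b ≠ 0 := by
  intro h
  refine ht.ne ?_
  rw [eq_div_iff ha]
  linarith

/-- The fundamental theorem of calculus for an integrand continuous on a left ray. -/
theorem ContinuousOn.hasDerivAt_integral_of_Iio {h : ℝ → ℝ} {c a b : ℝ}
    (hh : ContinuousOn h (Iio c)) (ha : a < c) (hb : b < c) :
    HasDerivAt (fun t => ∫ σ in a..t, h σ) (h b) b := by
  have hsub : uIcc a b ⊆ Iio c := ordConnected_Iio.uIcc_subset ha hb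
  exact integral_hasDerivAt_right (hh.mono hsub).intervalIntegrable
    (hh.stronglyMeasurableAtFilter isOpen_Iio b hb)
    (hh.continuousAt (Iio_mem_nhds hb))

/-- Explicit eikonal solutions on semi-Euclidean space (Example 1):
if `⟪∇f, J ∇f⟫ = 4 α f + β` with `α ≠ 0`, `t⋆ = -β/(4α)`, and
`w t = ∫_{t₀}^t √(Û(σ)/(4ασ+β)) dσ`, then `u = w ∘ f` solves the eikonal
equation `⟪∇u, J ∇u⟫ = Û ∘ f` on `{f < t⋆}` and is constant on level sets of `f`. -/
theorem semiEuclidean_eikonal_explicit_solution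
    {E : Type*} [NormedAddCommGroup E] [InnerProductSpace ℝ E] [CompleteSpace E]
    (J : E →L[ℝ] E) (hJsymm : ∀ x y : E, ⟪J x, y⟫ = ⟪x, J y⟫)
    (hJinv : ∀ x : E, J (J x) = x)
    (α β : ℝ) (hα : α ≠ 0)
    (f : E → ℝ) (hf : Differentiable ℝ f)
    (hfe : ∀ x : E, ⟪gradient f x, J (gradient f x)⟫ = 4 * α * f x + β)
    (U : ℝ → ℝ) (hU : Continuous U)
    (hUnn : ∀ t < -β / (4 * α), 0 ≤ U t / (4 * α * t + β))
    (t₀ : ℝ) (ht₀ : t₀ < -β / (4 * α))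
    (w : ℝ → ℝ)
    (hw : ∀ t, w t = ∫ σ in t₀..t, Real.sqrt (U σ / (4 * α * σ + β))) :
    (∀ x : E, f x < -β / (4 * α) →
        ⟪gradient (w ∘ f) x, J (gradient (w ∘ f) x)⟫ = U (f x)) ∧
      (∀ x y : E, f x = f y → (w ∘ f) x = (w ∘ f) y) := by
  refine ⟨fun x hx => ?_, fun x y hxy => congrArg w hxy⟩
  have hne : ∀ t < -β / (4 * α), 4 * α * t + β ≠ 0 := fun t ht =>
    affine_ne_zero_of_lt_root (mul_ne_zero four_ne_zero hα) ht
  have hcont : ContinuousOn (fun σ => Real.sqrt (U σ / (4 * α * σ + β)))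
      (Iio (-β / (4 * α))) :=
    (hU.continuousOn.div (by fun_prop) hne).sqrt
  have hderiv : HasDerivAt w (Real.sqrt (U (f x) / (4 * α * f x + β))) (f x) := by
    rw [funext hw]
    exact hcont.hasDerivAt_integral_of_Iio ht₀ hx
  rw [(hderiv.comp_hasGradientAt_scalar (hf x).hasGradientAt).gradient, map_smul,
    real_inner_smul_left, real_inner_smul_right, hfe, ← mul_assoc,
    Real.mul_self_sqrt (hUnn _ hx), div_mul_cancel₀ _ (hne _ hx)]
end

section
/- Reduced eikonal equation on the sphere, trigonometric case (Example 2): let ℓ > 0 be real, Û : ℝ → ℝ continuous with Û(τ) > 0 for all τ ∈ [−1, 1], and fix s₀ ∈ (0, π). Define v : (0, π) → ℝ by v(s) := (1/ℓ) ∫_{s₀}^{s} √(Û(cos ζ)) dζ and w := v ∘ arccos. Then for every t ∈ (−1, 1), w is differentiable at t and ℓ² (1 − t²) (deriv w t)² = Û(t). -/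
open Real Set intervalIntegral

/-- Reduced eikonal equation on the sphere, trigonometric case (Example 2):
with `v s = (1/ℓ) ∫_{s₀}^s √(Û(cos ζ)) dζ` and `w = v ∘ arccos`, the function `w`
is differentiable on `(-1, 1)` and satisfies `ℓ² (1 - t²) (w' t)² = Û t` there. -/
theorem sphere_reduced_eikonal_trigonometric
    (ℓ : ℝ) (hℓ : 0 < ℓ) (U : ℝ → ℝ) (hU : Continuous U)
    (hUpos : ∀ τ ∈ Set.Icc (-1 : ℝ) 1, 0 < U τ)
    (s₀ : ℝ) (hs₀ : s₀ ∈ Set.Ioo 0 π)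
    (v w : ℝ → ℝ)
    (hv : ∀ s, v s = (1 / ℓ) * ∫ ζ in s₀..s, Real.sqrt (U (Real.cos ζ)))
    (hw : w = v ∘ Real.arccos) :
    ∀ t ∈ Set.Ioo (-1 : ℝ) 1,
      DifferentiableAt ℝ w t ∧ ℓ ^ 2 * (1 - t ^ 2) * (deriv w t) ^ 2 = U t := by
  intro t ht
  have hcont : Continuous fun ζ => Real.sqrt (U (Real.cos ζ)) := by fun_prop
  have hv' : HasDerivAt v ((1 / ℓ) * Real.sqrt (U t)) (Real.arccos t) := by
    have h := (hcont.integral_hasStrictDerivAt s₀ (Real.arccos t)).hasDerivAt.const_mul (1 / ℓ)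
    rw [Real.cos_arccos ht.1.le ht.2.le] at h
    rwa [funext hv]
  have hw' : HasDerivAt w ((1 / ℓ) * Real.sqrt (U t) * -(1 / Real.sqrt (1 - t ^ 2))) t := by
    rw [hw]
    exact hv'.comp t (Real.hasDerivAt_arccos ht.1.ne' ht.2.ne)
  refine ⟨hw'.differentiableAt, ?_⟩
  have hpos : 0 < 1 - t ^ 2 := by nlinarith [ht.1, ht.2]
  have hUt : 0 ≤ U t := (hUpos t ⟨ht.1.le, ht.2.le⟩).le
  rw [hw'.deriv, mul_pow, mul_pow, neg_sq, div_pow, div_pow, Real.sq_sqrt hUt,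
    Real.sq_sqrt hpos.le]
  field_simp
end

section
/- Two-dimensional reduction (Proposition 2, warped-product model): let E₁, E₂ be real inner product spaces, f_L : E₁ → ℝ transnormal with eikonal function a_L, f_N : E₂ → ℝ transnormal with eikonal function a_N, α̂ : ℝ → ℝ positive, F̂ : ℝ × ℝ × ℝ × ℝ → ℝ any function, and w : ℝ × ℝ → ℝ differentiable. Set u(x, z) := w(f_L x, f_N z) and Q(u)(x,z) := −‖∇_x u(x,z)‖² + α̂(f_L x)⁻² ‖∇_z u(x,z)‖². Then F̂(f_L x, f_N z, u(x,z), Q(u)(x,z)) = 0 for all (x, z) ∈ E₁ × E₂ if and only if F̂(t, s, w(t,s), −a_L(t) (∂w/∂t)²(t,s) + (a_N(s)/α̂(t)²) (∂w/∂s)²(t,s)) = 0 for all (t, s) in (range f_L) × (range f_N). -/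
open Real Set

/-- Chain rule for the norm of the gradient of `g ∘ f` with `g` a function of one real variable. -/
theorem norm_gradient_comp_sq {E : Type*} [NormedAddCommGroup E] [InnerProductSpace ℝ E]
    [CompleteSpace E] {f : E → ℝ} {g : ℝ → ℝ} {x : E}
    (hf : DifferentiableAt ℝ f x) (hg : DifferentiableAt ℝ g (f x)) :
    ‖gradient (fun y => g (f y)) x‖ ^ 2 = ‖gradient f x‖ ^ 2 * deriv g (f x) ^ 2 := by
  have h : fderiv ℝ (fun y => g (f y)) x = deriv g (f x) • fderiv ℝ f x :=
    (hg.hasDerivAt.comp_hasFDerivAt x hf.hasFDerivAt).fderiv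
  simp only [gradient, LinearIsometryEquiv.norm_map, h, norm_smul, mul_pow, Real.norm_eq_abs,
    sq_abs]
  ring

/-- Two-dimensional reduction (Proposition 2, warped-product model):
`u (x,z) = w (f_L x, f_N z)` solves `F̂(f_L x, f_N z, u, Q(u)) = 0` on `E₁ × E₂`
iff `w` solves the reduced two-dimensional equation on
`(range f_L) × (range f_N)`. -/
theorem two_dimensional_reduction
    {E₁ E₂ : Type*} [NormedAddCommGroup E₁] [InnerProductSpace ℝ E₁] [CompleteSpace E₁]
    [NormedAddCommGroup E₂] [InnerProductSpace ℝ E₂] [CompleteSpace E₂]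
    (fL : E₁ → ℝ) (hfL : Differentiable ℝ fL)
    (aL : ℝ → ℝ) (haL : ∀ x : E₁, ‖gradient fL x‖ ^ 2 = aL (fL x))
    (fN : E₂ → ℝ) (hfN : Differentiable ℝ fN)
    (aN : ℝ → ℝ) (haN : ∀ z : E₂, ‖gradient fN z‖ ^ 2 = aN (fN z))
    (αh : ℝ → ℝ) (hαh : ∀ t : ℝ, 0 < αh t)
    (F : ℝ × ℝ × ℝ × ℝ → ℝ)
    (w : ℝ × ℝ → ℝ) (hw : Differentiable ℝ w)
    (u : E₁ × E₂ → ℝ) (hu : ∀ (x : E₁) (z : E₂), u (x, z) = w (fL x, fN z)) :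
    (∀ (x : E₁) (z : E₂),
        F (fL x, fN z, u (x, z),
            -‖gradient (fun x' => u (x', z)) x‖ ^ 2 +
              (αh (fL x) ^ 2)⁻¹ * ‖gradient (fun z' => u (x, z')) z‖ ^ 2) = 0) ↔
      (∀ t ∈ Set.range fL, ∀ s ∈ Set.range fN,
        F (t, s, w (t, s),
            -aL t * (deriv (fun t' => w (t', s)) t) ^ 2 +
              (aN s / αh t ^ 2) * (deriv (fun s' => w (t, s')) s) ^ 2) = 0) := by
  have key (x : E₁) (z : E₂) :
      -‖gradient (fun x' => u (x', z)) x‖ ^ 2 +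
          (αh (fL x) ^ 2)⁻¹ * ‖gradient (fun z' => u (x, z')) z‖ ^ 2 =
        -aL (fL x) * (deriv (fun t' => w (t', fN z)) (fL x)) ^ 2 +
          (aN (fN z) / αh (fL x) ^ 2) * (deriv (fun s' => w (fL x, s')) (fN z)) ^ 2 := by
    have hx : Differentiable ℝ fun t' => w (t', fN z) := by fun_prop
    have hz : Differentiable ℝ fun s' => w (fL x, s') := by fun_prop
    simp only [hu]
    rw [norm_gradient_comp_sq (hfL x) (hx (fL x)), norm_gradient_comp_sq (hfN z) (hz (fN z)),
      haL, haN]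
    ring
  simp only [Set.forall_mem_range, key]
  simp only [hu]
end
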